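/- Let φmin(δ) denote, for δ > 0, the unique solution in (0, π/3) of 1 + δ + F(φ) = 0, and let I(δ) = ∫_{φmin(δ)}^{π} (1 + δ + F(φ))^{-1/2} dφ. There exist constants C > 0 and δ₀ ∈ (0,1) such that I is differentiable on (0, δ₀) and for all δ ∈ (0, δ₀), |I′(δ) + √(6/7)/δ| ≤ C·δ^(−1/2). (This is the asymptotic expansion of the derivative of the semi-fast period with respect to the energy shift δ, which gives ν′_δ ∼ υ₀√ε·K/(δ·|ln δ|²).) -/

import Mathlib

open Real MeasureTheory

/-- The normalized potential of the reduced semi-fast co-orbital mechanical system. -/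
noncomputable def F (φ : ℝ) : ℝ :=
  (2/3) * (Real.cos φ - (2 - 2 * Real.cos φ) ^ (-(1:ℝ)/2))

open Set Filter Topology

theorem hasDerivAt_mul_sqrt (x : ℝ) : HasDerivAt (fun y => y * √y) (3 / 2 * √x) x := by
  rcases eq_or_ne x 0 with rfl | hx
  · rw [hasDerivAt_iff_tendsto_slope_zero]
    have h : Tendsto (fun t : ℝ => √t) (𝓝[≠] 0) (𝓝 (3 / 2 * √0)) := by
      have := (continuous_sqrt.tendsto (0 : ℝ)).mono_left (nhdsWithin_le_nhds (s := {0}ᶜ))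
      simpa using this
    refine h.congr' ?_
    filter_upwards [self_mem_nhdsWithin] with t ht
    have ht : t ≠ 0 := ht
    simp [ht]
  · refine ((hasDerivAt_id x).mul (hasDerivAt_sqrt hx)).congr_deriv ?_
    have h : x / √x = √x := div_sqrt
    rw [id, one_mul, mul_one_div, mul_comm 2, ← div_div, h]
    ring

/-- Twofold integration by parts for the time integral near a simple turning point `c`.
Here `m` is the reciprocal of the derivative of `G`. -/
theorem integral_inv_sqrt_add_eq {G m n p : ℝ → ℝ} {c a t : ℝ} (hca : c ≤ a)
    (hG : ∀ x ∈ Icc c a, HasDerivAt G (m x)⁻¹ x) (hm : ∀ x ∈ Icc c a, 0 < m x)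
    (hmn : ∀ x ∈ Icc c a, HasDerivAt m (n x) x)
    (hnp : ∀ x ∈ Icc c a, HasDerivAt (fun y => n y * m y) (p x) x)
    (hp : ContinuousOn p (Icc c a)) (hc : t + G c = 0) :
    IntervalIntegrable (fun x => (√(t + G x))⁻¹) volume c a ∧
    ∫ x in c..a, (√(t + G x))⁻¹ =
      2 * √(t + G a) * m a - 4 / 3 * ((t + G a) * √(t + G a)) * (n a * m a)
        + 4 / 3 * ∫ x in c..a, (t + G x) * √(t + G x) * p x := by
  have hGc : ContinuousOn G (Icc c a) := fun x hx => (hG x hx).continuousAt.continuousWithinAt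
  have hmc : ContinuousOn m (Icc c a) := fun x hx => (hmn x hx).continuousAt.continuousWithinAt
  have hnmc : ContinuousOn (fun y => n y * m y) (Icc c a) :=
    fun x hx => (hnp x hx).continuousAt.continuousWithinAt
  have hmono : StrictMonoOn G (Icc c a) := by
    refine strictMonoOn_of_deriv_pos (convex_Icc c a) hGc fun x hx => ?_
    have hx := interior_subset hx
    rw [(hG x hx).deriv]
    exact inv_pos.2 (hm x hx)
  have hpos : ∀ x ∈ Ioo c a, 0 < t + G x := fun x hx => by
    have := hmono (left_mem_Icc.2 hca) (Ioo_subset_Icc_self hx) hx.1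
    linarith
  have hsq : ContinuousOn (fun x => √(t + G x)) (Icc c a) :=
    (continuousOn_const.add hGc).sqrt
  have hds : ∀ x ∈ Ioo c a,
      HasDerivAt (fun x => 2 * √(t + G x)) ((√(t + G x))⁻¹ * (m x)⁻¹) x := fun x hx => by
    refine ((((hG x (Ioo_subset_Icc_self hx)).const_add t).sqrt (hpos x hx).ne').const_mul
      2).congr_deriv ?_
    have := (sqrt_pos.2 (hpos x hx)).ne'
    have := (hm x (Ioo_subset_Icc_self hx)).ne'
    field_simp
  have hI : IntervalIntegrable (fun x => (√(t + G x))⁻¹) volume c a := by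
    have h1 : IntervalIntegrable (fun x => (√(t + G x))⁻¹ * (m x)⁻¹) volume c a := by
      refine intervalIntegral.intervalIntegrable_deriv_of_nonneg
        (g := fun x => 2 * √(t + G x)) ?_ ?_ ?_
      · rw [uIcc_of_le hca]; exact continuousOn_const.mul hsq
      · rw [min_eq_left hca, max_eq_right hca]; exact hds
      · rw [min_eq_left hca, max_eq_right hca]
        intro x hx
        have := hm x (Ioo_subset_Icc_self hx)
        positivity
    have h2 := h1.mul_continuousOn (g := m) (by rwa [uIcc_of_le hca])
    refine h2.congr fun x hx => ?_
    rw [uIoc_of_le hca] at hx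
    have := (hm x (Ioc_subset_Icc_self hx)).ne'
    field_simp
  have hcont : ContinuousOn (fun x => (t + G x) * √(t + G x) * p x) (Icc c a) :=
    ((continuousOn_const.add hGc).mul hsq).mul hp
  have hJ : IntervalIntegrable (fun x => (t + G x) * √(t + G x) * p x) volume c a :=
    ContinuousOn.intervalIntegrable (by rwa [uIcc_of_le hca])
  refine ⟨hI, ?_⟩
  have key := intervalIntegral.integral_eq_sub_of_hasDerivAt_of_le
    (f := fun x => 2 * √(t + G x) * m x - 4 / 3 * ((t + G x) * √(t + G x)) * (n x * m x))
    (f' := fun x => (√(t + G x))⁻¹ - 4 / 3 * ((t + G x) * √(t + G x) * p x)) hca ?_ ?_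
    (hI.sub (hJ.const_mul _))
  · rw [intervalIntegral.integral_sub hI (hJ.const_mul _), intervalIntegral.integral_const_mul]
      at key
    simp only [hc, sqrt_zero, mul_zero, zero_mul, sub_zero] at key
    linarith
  · exact ((continuousOn_const.mul hsq).mul hmc).sub
      ((continuousOn_const.mul ((continuousOn_const.add hGc).mul hsq)).mul hnmc)
  · intro x hx
    have hx' := Ioo_subset_Icc_self hx
    have h1 := (hds x hx).mul (hmn x hx')
    have h2 := (((hasDerivAt_mul_sqrt (t + G x)).comp x ((hG x hx').const_add t)).const_mul
      (4 / 3)).mul (hnp x hx')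
    refine (h1.sub h2).congr_deriv ?_
    have := (hm x hx').ne'
    simp only [Function.comp]
    field_simp
    ring

/-- Differentiation under the integral sign for a fixed interval containing the turning points. -/
theorem hasDerivAt_integral_add_mul_sqrt {G p : ℝ → ℝ} {c a t : ℝ} (hca : c ≤ a)
    (hG : ContinuousOn G (Icc c a)) (hp : ContinuousOn p (Icc c a)) :
    HasDerivAt (fun t => ∫ x in c..a, (t + G x) * √(t + G x) * p x)
      (∫ x in c..a, 3 / 2 * √(t + G x) * p x) t := by
  have hIcc : uIoc c a ⊆ Icc c a := by rw [uIoc_of_le hca]; exact Ioc_subset_Icc_self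
  have hc1 : ∀ s, ContinuousOn (fun x => (s + G x) * √(s + G x) * p x) (Icc c a) := fun s =>
    ((continuousOn_const.add hG).mul (continuousOn_const.add hG).sqrt).mul hp
  have hc2 : ∀ s, ContinuousOn (fun x => 3 / 2 * √(s + G x) * p x) (Icc c a) := fun s =>
    (continuousOn_const.mul (continuousOn_const.add hG).sqrt).mul hp
  have hmeas : ∀ {f : ℝ → ℝ}, ContinuousOn f (Icc c a) →
      AEStronglyMeasurable f (volume.restrict (uIoc c a)) := fun hf =>
    (hf.mono hIcc).aestronglyMeasurable measurableSet_uIoc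
  refine (intervalIntegral.hasDerivAt_integral_of_dominated_loc_of_deriv_le
    (F := fun t x => (t + G x) * √(t + G x) * p x)
    (F' := fun t x => 3 / 2 * √(t + G x) * p x)
    (bound := fun x => 3 / 2 * √(t + 1 + G x) * |p x|)
    (Iio_mem_nhds (lt_add_one t)) (Eventually.of_forall fun s => hmeas (hc1 s))
    (ContinuousOn.intervalIntegrable (by rw [uIcc_of_le hca]; exact hc1 t))
    (hmeas (hc2 t)) (Eventually.of_forall fun x _ s hs => ?_)
    (ContinuousOn.intervalIntegrable ?_) (Eventually.of_forall fun x _ s hs => ?_)).2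
  · have hs : s < t + 1 := hs
    rw [norm_mul, norm_of_nonneg (by positivity), Real.norm_eq_abs]
    gcongr
  · rw [uIcc_of_le hca]
    exact (continuousOn_const.mul (continuousOn_const.add hG).sqrt).mul hp.abs
  · refine (((hasDerivAt_mul_sqrt (s + G x)).comp s
      ((hasDerivAt_id s).add_const (G x))).mul_const (p x)).congr_deriv ?_
    ring

/-- The part of the period integral near a simple turning point has bounded derivative. -/
theorem exists_bound_deriv_integral_turning_point {G c : ℝ → ℝ} {A B a T : ℝ}
    (hG : ContDiffOn ℝ 3 G (Ioo A B)) (hG' : ∀ x ∈ Ioo A B, 0 < deriv G x)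
    (ha : a ∈ Ioo A B) (hGa : 0 < G a) (hT : 0 < T)
    (hc : ∀ t ∈ Ioc 0 T, c t ∈ Ioo A B ∧ t + G (c t) = 0) :
    ∃ C, ∀ δ ∈ Ioo 0 T, IntervalIntegrable (fun x => (√(δ + G x))⁻¹) volume (c δ) a ∧
      ∃ d, HasDerivAt (fun t => ∫ x in (c t)..a, (√(t + G x))⁻¹) d δ ∧ |d| ≤ C := by
  have hmono : StrictMonoOn G (Ioo A B) := by
    refine strictMonoOn_of_deriv_pos (convex_Ioo A B) hG.continuousOn fun x hx => ?_
    exact hG' x (interior_subset hx)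
  obtain ⟨hc0, hGc0⟩ := hc T ⟨hT, le_rfl⟩
  have hct : ∀ t ∈ Ioo 0 T, c T ≤ c t ∧ c t ≤ a := fun t ht => by
    obtain ⟨h1, h2⟩ := hc t ⟨ht.1, ht.2.le⟩
    have := ht.1
    have := ht.2
    exact ⟨(hmono.le_iff_le hc0 h1).1 (by linarith), (hmono.le_iff_le h1 ha).1 (by linarith)⟩
  have hca : c T ≤ a := (hmono.le_iff_le hc0 ha).1 (by linarith)
  have hsub : Icc (c T) a ⊆ Ioo A B := fun x hx => ⟨hc0.1.trans_le hx.1, hx.2.trans_lt ha.2⟩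
  set m : ℝ → ℝ := fun x => (deriv G x)⁻¹ with hm
  have hdG : ContDiffOn ℝ 2 (deriv G) (Ioo A B) := hG.deriv_of_isOpen isOpen_Ioo (by norm_num)
  have hmC : ContDiffOn ℝ 2 m (Ioo A B) := hdG.inv fun x hx => (hG' x hx).ne'
  have hnC : ContDiffOn ℝ 1 (deriv m) (Ioo A B) :=
    hmC.deriv_of_isOpen isOpen_Ioo (by norm_num)
  have hnmC : ContDiffOn ℝ 1 (fun x => deriv m x * m x) (Ioo A B) :=
    hnC.mul (hmC.of_le (by norm_num))
  set p := deriv (fun x => deriv m x * m x) with hp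
  have hpC : ContinuousOn p (Ioo A B) := hnmC.continuousOn_deriv_of_isOpen isOpen_Ioo le_rfl
  have hD : ∀ {f : ℝ → ℝ} {k : WithTop ℕ∞}, ContDiffOn ℝ k f (Ioo A B) → k ≠ 0 →
      ∀ x ∈ Ioo A B, HasDerivAt f (deriv f x) x := fun hf hk x hx =>
    ((hf.contDiffAt (isOpen_Ioo.mem_nhds hx)).differentiableAt hk).hasDerivAt
  have hform : ∀ t ∈ Ioo 0 T, _ := fun t ht =>
    have hs : Icc (c t) a ⊆ Ioo A B := (Icc_subset_Icc_left (hct t ht).1).trans hsub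
    integral_inv_sqrt_add_eq (G := G) (m := m) (n := deriv m) (p := p) (t := t) (hct t ht).2
      (fun x hx => by
        rw [hm, inv_inv]
        exact hD hG (by norm_num) x (hs hx))
      (fun x hx => inv_pos.2 (hG' x (hs hx)))
      (fun x hx => hD hmC (by norm_num) x (hs hx))
      (fun x hx => hD hnmC (by norm_num) x (hs hx))
      (hpC.mono hs) (hc t ⟨ht.1, ht.2.le⟩).2
  have hGc : ContinuousOn G (Icc (c T) a) := hG.continuousOn.mono hsub
  have hpc : ContinuousOn p (Icc (c T) a) := hpC.mono hsub
  have hext : ∀ t ∈ Ioo 0 T, ∫ x in (c t)..a, (t + G x) * √(t + G x) * p x =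
      ∫ x in (c T)..a, (t + G x) * √(t + G x) * p x := fun t ht => by
    have hcont : ContinuousOn (fun x => (t + G x) * √(t + G x) * p x) (Icc (c T) a) :=
      ((continuousOn_const.add hGc).mul (continuousOn_const.add hGc).sqrt).mul hpc
    have hii : ∀ u v, u ∈ Icc (c T) a → v ∈ Icc (c T) a → IntervalIntegrable
        (fun x => (t + G x) * √(t + G x) * p x) volume u v := fun u v hu hv =>
      (hcont.mono (uIcc_subset_Icc hu hv)).intervalIntegrable
    have hmem : c t ∈ Icc (c T) a := hct t ht
    rw [← intervalIntegral.integral_add_adjacent_intervals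
      (hii _ _ (left_mem_Icc.2 hca) hmem) (hii _ _ hmem (right_mem_Icc.2 hca)),
      right_eq_add]
    refine intervalIntegral.integral_zero_ae (Eventually.of_forall fun x hx => ?_)
    rw [uIoc_of_le hmem.1] at hx
    obtain ⟨h1, h2⟩ := hc t ⟨ht.1, ht.2.le⟩
    have := hmono.monotoneOn (hsub ⟨hx.1.le, hx.2.trans hmem.2⟩) h1 hx.2
    rw [sqrt_eq_zero_of_nonpos (by linarith)]
    simp
  obtain ⟨P, hP⟩ := isCompact_Icc.exists_bound_of_continuousOn hpc
  refine ⟨(√(G a))⁻¹ * |m a| + 2 * √(T + G a) * |deriv m a * m a|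
    + 4 / 3 * (3 / 2 * √(T + G a) * P * |a - c T|), fun δ hδ => ⟨(hform δ hδ).1,
    (√(δ + G a))⁻¹ * m a - 2 * √(δ + G a) * (deriv m a * m a)
      + 4 / 3 * ∫ x in (c T)..a, 3 / 2 * √(δ + G x) * p x, ?_, ?_⟩⟩
  · have hpos : 0 < δ + G a := by linarith [hδ.1]
    have hadd : HasDerivAt (fun t => t + G a) 1 δ := (hasDerivAt_id δ).add_const _
    have h1 := ((hadd.sqrt hpos.ne').const_mul 2).mul_const (m a)
    have h2 := (((hasDerivAt_mul_sqrt (δ + G a)).comp δ hadd).const_mul (4 / 3)).mul_const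
      (deriv m a * m a)
    have h3 := (hasDerivAt_integral_add_mul_sqrt (t := δ) hca hGc hpc).const_mul (4 / 3)
    have h4 := (h1.sub h2).add h3
    refine (h4.congr_of_eventuallyEq ?_).congr_deriv ?_
    · filter_upwards [Ioo_mem_nhds hδ.1 hδ.2] with t ht
      rw [(hform t ht).2, hext t ht]
      rfl
    · have := (sqrt_pos.2 hpos).ne'
      field_simp
      ring
  · have hle : √(δ + G a) ≤ √(T + G a) := sqrt_le_sqrt (by linarith [hδ.2])
    have hP0 : 0 ≤ P := (norm_nonneg _).trans (hP a (right_mem_Icc.2 hca))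
    have hint : |∫ x in (c T)..a, 3 / 2 * √(δ + G x) * p x| ≤
        3 / 2 * √(T + G a) * P * |a - c T| := by
      rw [← Real.norm_eq_abs]
      refine intervalIntegral.norm_integral_le_of_norm_le_const fun x hx => ?_
      rw [uIoc_of_le hca] at hx
      have hx' := Ioc_subset_Icc_self hx
      have hGx := hmono.monotoneOn (hsub hx') ha hx.2
      rw [norm_mul, Real.norm_of_nonneg (by positivity)]
      have := hP x hx'
      have := hδ.2
      gcongr
    have hinv : (√(δ + G a))⁻¹ ≤ (√(G a))⁻¹ :=
      inv_anti₀ (sqrt_pos.2 hGa) (sqrt_le_sqrt (by linarith [hδ.1]))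
    refine (abs_add_le _ _).trans (add_le_add ((abs_sub _ _).trans (add_le_add ?_ ?_)) ?_)
    · rw [abs_mul, abs_of_nonneg (by positivity)]
      gcongr
    · rw [abs_mul, abs_of_nonneg (by positivity : 0 ≤ 2 * √(δ + G a))]
      gcongr
    · rw [abs_mul, abs_of_nonneg (by norm_num : (0 : ℝ) ≤ 4 / 3)]
      gcongr

theorem hasDerivAt_integral_inv_sqrt_add {G : ℝ → ℝ} {a b δ : ℝ} (hab : a ≤ b)
    (hG : ContinuousOn G (Icc a b)) (h0 : ∀ x ∈ Icc a b, 0 ≤ G x) (hδ : 0 < δ) :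
    IntervalIntegrable (fun x => (√(δ + G x))⁻¹) volume a b ∧
    HasDerivAt (fun t => ∫ x in a..b, (√(t + G x))⁻¹)
      (∫ x in a..b, -(1 / 2) * ((δ + G x) * √(δ + G x))⁻¹) δ := by
  have hIcc : uIoc a b ⊆ Icc a b := by rw [uIoc_of_le hab]; exact Ioc_subset_Icc_self
  have hpos : ∀ s, 0 < s → ∀ x ∈ Icc a b, 0 < s + G x := fun s hs x hx =>
    add_pos_of_pos_of_nonneg hs (h0 x hx)
  have hc1 : ∀ s, 0 < s → ContinuousOn (fun x => (√(s + G x))⁻¹) (Icc a b) := fun s hs =>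
    (continuousOn_const.add hG).sqrt.inv₀ fun x hx => (sqrt_pos.2 (hpos s hs x hx)).ne'
  have hc2 : ContinuousOn (fun x => -(1 / 2) * ((δ + G x) * √(δ + G x))⁻¹) (Icc a b) :=
    continuousOn_const.mul <| ((continuousOn_const.add hG).mul
      (continuousOn_const.add hG).sqrt).inv₀ fun x hx =>
        (mul_pos (hpos δ hδ x hx) (sqrt_pos.2 (hpos δ hδ x hx))).ne'
  have hmeas : ∀ {f : ℝ → ℝ}, ContinuousOn f (Icc a b) →
      AEStronglyMeasurable f (volume.restrict (uIoc a b)) := fun hf =>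
    (hf.mono hIcc).aestronglyMeasurable measurableSet_uIoc
  have hI : IntervalIntegrable (fun x => (√(δ + G x))⁻¹) volume a b :=
    ContinuousOn.intervalIntegrable (by rw [uIcc_of_le hab]; exact hc1 δ hδ)
  refine ⟨hI, (intervalIntegral.hasDerivAt_integral_of_dominated_loc_of_deriv_le
    (F := fun t x => (√(t + G x))⁻¹)
    (F' := fun t x => -(1 / 2) * ((t + G x) * √(t + G x))⁻¹)
    (bound := fun x => 1 / 2 * ((δ / 2) * √(δ / 2))⁻¹)
    (Ioi_mem_nhds (half_lt_self hδ)) ?_ hI (hmeas hc2)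
    (Eventually.of_forall fun x hx s hs => ?_)
    intervalIntegrable_const (Eventually.of_forall fun x hx s hs => ?_)).2⟩
  · filter_upwards [Ioi_mem_nhds hδ] with s hs using hmeas (hc1 s hs)
  · have hs : δ / 2 < s := hs
    have := h0 x (hIcc hx)
    rw [norm_mul, norm_neg, Real.norm_of_nonneg (by norm_num : (0 : ℝ) ≤ 1 / 2),
      norm_inv, Real.norm_of_nonneg (mul_nonneg (by linarith) (sqrt_nonneg _))]
    have hle : δ / 2 ≤ s + G x := by linarith
    have := (half_pos hδ).trans_le hle
    gcongr
  · have hs : δ / 2 < s := hs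
    have hp := hpos s (by linarith) x (hIcc hx)
    have hs0 := sqrt_pos.2 hp
    refine ((((hasDerivAt_id s).add_const (G x)).sqrt hp.ne').inv hs0.ne').congr_deriv ?_
    simp only [id, sq_sqrt hp.le]
    field_simp

/-- Asymptotics of the derivative of the passage time near a saddle, with the potential written
as the square of a function `g` vanishing simply at `b`. -/
theorem abs_integral_inv_mul_sqrt_sub_le {g g' : ℝ → ℝ} {a b κ m L δ : ℝ} (hab : a < b)
    (hg : ∀ x ∈ Icc a b, HasDerivAt g (g' x) x) (hg' : ContinuousOn g' (Icc a b))
    (hgb : g b = 0) (hκ : 0 < κ) (hm : 0 < m) (hL : 0 ≤ L)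
    (hgm : ∀ x ∈ Icc a b, m * (b - x) ≤ -g x)
    (hgL : ∀ x ∈ Icc a b, |g' x - κ| ≤ L * (b - x)) (hδ : 0 < δ) :
    |(∫ x in a..b, ((δ + g x ^ 2) * √(δ + g x ^ 2))⁻¹) - 1 / (κ * δ)| ≤
      κ⁻¹ * (((g a) ^ 2)⁻¹ + L / m ^ 2 * (√δ)⁻¹) := by
  have hgc : ContinuousOn g (Icc a b) := fun x hx => (hg x hx).continuousAt.continuousWithinAt
  have hpos : ∀ x, 0 < δ + g x ^ 2 := fun x => by positivity
  have hwc : ContinuousOn (fun x => ((δ + g x ^ 2) * √(δ + g x ^ 2))⁻¹) (Icc a b) :=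
    ((continuousOn_const.add (hgc.pow 2)).mul (continuousOn_const.add (hgc.pow 2)).sqrt).inv₀
      fun x _ => (mul_pos (hpos x) (sqrt_pos.2 (hpos x))).ne'
  have hii : ∀ {f : ℝ → ℝ}, ContinuousOn f (Icc a b) → IntervalIntegrable f volume a b :=
    fun hf => ContinuousOn.intervalIntegrable (by rwa [uIcc_of_le hab.le])
  have h1 : ∫ x in a..b, g' x * ((δ + g x ^ 2) * √(δ + g x ^ 2))⁻¹ =
      1 / δ * (-g a / √(δ + g a ^ 2)) := by
    rw [intervalIntegral.integral_eq_sub_of_hasDerivAt_of_le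
      (f := fun x => 1 / δ * (g x / √(δ + g x ^ 2)))
      (f' := fun x => g' x * ((δ + g x ^ 2) * √(δ + g x ^ 2))⁻¹) hab.le ?_ ?_
      (hii (hg'.mul hwc))]
    · simp only [hgb]
      ring
    · exact continuousOn_const.mul (hgc.div (continuousOn_const.add (hgc.pow 2)).sqrt
        fun x _ => (sqrt_pos.2 (hpos x)).ne')
    · intro x hx
      have hd := hg x (Ioo_subset_Icc_self hx)
      have hs := sqrt_pos.2 (hpos x)
      refine ((hd.div (((hd.pow 2).const_add δ).sqrt (hpos x).ne') hs.ne').const_mul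
        (1 / δ)).congr_deriv ?_
      have hp := hpos x
      have hsq := sq_sqrt hp.le
      generalize hS : √(δ + g x ^ 2) = S at hs hsq
      simp only [hsq]
      rw [← hsq]
      field_simp
      linear_combination (2 * g' x) * hsq
  have h2 : |∫ x in a..b, (g' x - κ) * ((δ + g x ^ 2) * √(δ + g x ^ 2))⁻¹| ≤
      L / m ^ 2 * (√δ)⁻¹ := by
    have hq : ∀ x, 0 < δ + m ^ 2 * (b - x) ^ 2 := fun x => by positivity
    have hqc : Continuous fun x => δ + m ^ 2 * (b - x) ^ 2 := by fun_prop
    have hbc : Continuous fun x => L * (b - x) *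
        ((δ + m ^ 2 * (b - x) ^ 2) * √(δ + m ^ 2 * (b - x) ^ 2))⁻¹ :=
      (by fun_prop : Continuous fun x => L * (b - x)).mul
        ((hqc.mul hqc.sqrt).inv₀ fun x => (mul_pos (hq x) (sqrt_pos.2 (hq x))).ne')
    rw [← Real.norm_eq_abs]
    refine (intervalIntegral.norm_integral_le_of_norm_le hab.le (g := fun x => L * (b - x) *
      ((δ + m ^ 2 * (b - x) ^ 2) * √(δ + m ^ 2 * (b - x) ^ 2))⁻¹)
      (Eventually.of_forall fun x hx => ?_) (hbc.intervalIntegrable _ _)).trans ?_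
    · have hx := Ioc_subset_Icc_self hx
      have hbx : 0 ≤ b - x := sub_nonneg.2 hx.2
      have hle : m ^ 2 * (b - x) ^ 2 ≤ g x ^ 2 := by
        rw [← mul_pow, ← neg_sq (g x)]
        exact pow_le_pow_left₀ (by positivity) (hgm x hx) 2
      rw [norm_mul, Real.norm_eq_abs, norm_inv, Real.norm_of_nonneg (by positivity)]
      have := hgL x hx
      have := sqrt_pos.2 (hq x)
      have := hq x
      gcongr
    · rw [intervalIntegral.integral_eq_sub_of_hasDerivAt_of_le
        (f := fun x => L / m ^ 2 * (√(δ + m ^ 2 * (b - x) ^ 2))⁻¹) hab.le ?_ ?_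
        (hbc.intervalIntegrable _ _)]
      · have : 0 ≤ L / m ^ 2 * (√(δ + m ^ 2 * (b - a) ^ 2))⁻¹ := by positivity
        simpa using this
      · exact (continuous_const.mul (hqc.sqrt.inv₀
          fun x => (sqrt_pos.2 (hq x)).ne')).continuousOn
      · intro x _
        have hs := sqrt_pos.2 (hq x)
        have hd : HasDerivAt (fun x => δ + m ^ 2 * (b - x) ^ 2) (-(m ^ 2 * 2 * (b - x))) x := by
          refine ((((hasDerivAt_id x).const_sub b).pow 2).const_mul
            (m ^ 2)).const_add δ |>.congr_deriv ?_
          simp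
          ring
        refine (((hd.sqrt (hq x).ne').inv hs.ne').const_mul (L / m ^ 2)).congr_deriv ?_
        have hsq := sq_sqrt (hq x).le
        set S := √(δ + m ^ 2 * (b - x) ^ 2)
        rw [← hsq]
        field_simp
  have hsplit : κ * (∫ x in a..b, ((δ + g x ^ 2) * √(δ + g x ^ 2))⁻¹) =
      (∫ x in a..b, g' x * ((δ + g x ^ 2) * √(δ + g x ^ 2))⁻¹) -
      ∫ x in a..b, (g' x - κ) * ((δ + g x ^ 2) * √(δ + g x ^ 2))⁻¹ := by
    rw [← intervalIntegral.integral_const_mul]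
    refine .trans ?_ (intervalIntegral.integral_sub
      (hii (hg'.mul hwc)) (hii ((hg'.sub continuousOn_const).mul hwc)))
    congr 1
    ext x
    ring
  have h3 : |1 / δ * (-g a / √(δ + g a ^ 2)) - 1 / δ| ≤ (g a ^ 2)⁻¹ := by
    have hr : 0 < -g a :=
      (mul_pos hm (sub_pos.2 hab)).trans_le (hgm a (left_mem_Icc.2 hab.le))
    have hsq := sq_sqrt (hpos a).le
    have hS := sqrt_pos.2 (hpos a)
    set S := √(δ + g a ^ 2)
    have hrS : -g a ≤ S := by
      rw [← abs_of_pos hr, ← abs_of_pos hS, ← sq_le_sq, neg_sq]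
      linarith
    have hδ' : δ = S ^ 2 - g a ^ 2 := by linarith
    have e : 1 / δ * (-g a / S) - 1 / δ = -((S - -g a) / (δ * S)) := by
      field_simp
      ring
    rw [e, abs_neg, abs_of_nonneg (by have := sub_nonneg.2 hrS; positivity),
      ← one_div, div_le_div_iff₀ (by positivity) (by nlinarith)]
    set r := -g a
    have hga : g a ^ 2 = r ^ 2 := (neg_sq _).symm
    rw [hδ', hga]
    nlinarith [mul_nonneg (mul_nonneg (sub_nonneg.2 hrS) hr.le) hS.le,
      mul_nonneg (sub_nonneg.2 hrS) (mul_nonneg (sub_nonneg.2 hrS) hr.le),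
      mul_nonneg (sub_nonneg.2 hrS) (mul_nonneg (sub_nonneg.2 hrS) hS.le)]
  have hfin : (∫ x in a..b, ((δ + g x ^ 2) * √(δ + g x ^ 2))⁻¹) - 1 / (κ * δ) =
      κ⁻¹ * ((1 / δ * (-g a / √(δ + g a ^ 2)) - 1 / δ) -
        ∫ x in a..b, (g' x - κ) * ((δ + g x ^ 2) * √(δ + g x ^ 2))⁻¹) := by
    rw [h1] at hsplit
    field_simp at hsplit ⊢
    linear_combination hsplit
  rw [hfin, abs_mul, abs_of_pos (inv_pos.2 hκ)]
  gcongr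
  exact (abs_sub _ _).trans (add_le_add h3 h2)

theorem rpow_neg_half_eq_inv_sqrt (x : ℝ) : x ^ (-(1 : ℝ) / 2) = (√x)⁻¹ := by
  rcases le_or_gt 0 x with hx | hx
  · rw [neg_div, Real.rpow_neg hx, sqrt_eq_rpow]
  · rw [Real.rpow_def_of_neg hx, sqrt_eq_zero_of_nonpos hx.le,
      show -(1 : ℝ) / 2 * π = -(π / 2) by ring, Real.cos_neg, Real.cos_pi_div_two]
    simp

theorem one_add_F_eq {φ : ℝ} (hφ : 0 < sin (φ / 2)) :
    1 + F φ = 5 / 3 - 4 / 3 * sin (φ / 2) ^ 2 - (3 * sin (φ / 2))⁻¹ := by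
  have hcos : cos φ = 1 - 2 * sin (φ / 2) ^ 2 := by
    rw [show φ = 2 * (φ / 2) by ring, cos_two_mul, cos_sq']
    ring_nf
  rw [F, rpow_neg_half_eq_inv_sqrt, hcos,
    show 2 - 2 * (1 - 2 * sin (φ / 2) ^ 2) = (2 * sin (φ / 2)) ^ 2 by ring,
    sqrt_sq (by positivity)]
  field_simp
  ring

theorem hasDerivAt_one_add_F {φ : ℝ} (hφ : 0 < sin (φ / 2)) :
    HasDerivAt (fun x => 1 + F x)
      ((1 - 8 * sin (φ / 2) ^ 3) * cos (φ / 2) / (6 * sin (φ / 2) ^ 2)) φ := by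
  have hs : HasDerivAt (fun x => sin (x / 2)) (cos (φ / 2) * (1 / 2)) φ :=
    ((hasDerivAt_id φ).div_const 2).sin
  have h : HasDerivAt (fun x => 5 / 3 - 4 / 3 * sin (x / 2) ^ 2 - (3 * sin (x / 2))⁻¹)
      ((1 - 8 * sin (φ / 2) ^ 3) * cos (φ / 2) / (6 * sin (φ / 2) ^ 2)) φ := by
    refine ((((hs.pow 2).const_mul (4 / 3)).const_sub (5 / 3)).sub
      ((hs.const_mul 3).inv (by positivity))).congr_deriv ?_
    field_simp
    ring
  refine h.congr_of_eventuallyEq ?_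
  filter_upwards [(by fun_prop : ContinuousAt (fun x => sin (x / 2)) φ).eventually
    (lt_mem_nhds hφ)] with x hx using one_add_F_eq hx

/-- A smooth signed square root of `1 + F` near `π`. -/
noncomputable def sqrtPotential (φ : ℝ) : ℝ :=
  √2 * sin ((φ - π) / 4) *
    √((4 * sin (φ / 2) ^ 2 + 4 * sin (φ / 2) - 1) / (3 * sin (φ / 2)))

theorem sqrtPotential_sq {φ : ℝ} (h0 : 0 < sin (φ / 2))
    (h1 : 0 < 4 * sin (φ / 2) ^ 2 + 4 * sin (φ / 2) - 1) :
    sqrtPotential φ ^ 2 = 1 + F φ := by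
  have hs : 2 * sin ((φ - π) / 4) ^ 2 = 1 - sin (φ / 2) := by
    have h : cos (2 * ((φ - π) / 4)) = sin (φ / 2) := by
      rw [show 2 * ((φ - π) / 4) = φ / 2 - π / 2 by ring, cos_sub_pi_div_two]
    rw [cos_two_mul, cos_sq'] at h
    linarith
  rw [sqrtPotential, mul_pow, mul_pow, sq_sqrt zero_le_two, sq_sqrt (by positivity), hs,
    one_add_F_eq h0]
  field_simp
  ring

theorem contDiffOn_sqrtPotential {k : WithTop ℕ∞} : ContDiffOn ℝ k sqrtPotential
    {φ | 0 < sin (φ / 2) ∧ 0 < 4 * sin (φ / 2) ^ 2 + 4 * sin (φ / 2) - 1} := by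
  have hs : ContDiff ℝ k (fun φ : ℝ => sin (φ / 2)) := contDiff_sin.comp (contDiff_id.div_const 2)
  have hs' : ContDiff ℝ k (fun φ : ℝ => sin ((φ - π) / 4)) :=
    contDiff_sin.comp ((contDiff_id.sub contDiff_const).div_const 4)
  refine (contDiff_const.mul hs').contDiffOn.mul (ContDiffOn.sqrt ?_ fun φ hφ => ?_)
  · exact (((contDiff_const.mul (hs.pow 2)).add (contDiff_const.mul hs)).sub
      contDiff_const).contDiffOn.div (contDiff_const.mul hs).contDiffOn
      fun φ hφ => (mul_pos three_pos hφ.1).ne'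
  · exact (div_pos hφ.2 (mul_pos three_pos hφ.1)).ne'

theorem deriv_sqrtPotential_pi : deriv sqrtPotential π = √2 / 4 * √(7 / 3) := by
  have hd : DifferentiableAt ℝ
      (fun φ => √((4 * sin (φ / 2) ^ 2 + 4 * sin (φ / 2) - 1) / (3 * sin (φ / 2)))) π := by
    refine DifferentiableAt.sqrt (DifferentiableAt.div (by fun_prop) (by fun_prop) ?_) ?_ <;>
    · rw [sin_pi_div_two]
      norm_num
  have hs : HasDerivAt (fun φ => √2 * sin ((φ - π) / 4)) (√2 * (cos ((π - π) / 4) * (1 / 4))) π :=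
    ((((hasDerivAt_id π).sub_const π).div_const 4).sin).const_mul _
  have := (hs.mul hd.hasDerivAt).deriv
  rw [show sqrtPotential = _ from rfl]
  refine this.trans ?_
  rw [sin_pi_div_two]
  norm_num
  ring

theorem quarter_le_sin_half {φ : ℝ} (hφ : φ ∈ Icc (2 * arcsin (1 / 4)) π) :
    1 / 4 ≤ sin (φ / 2) := by
  rw [← sin_arcsin (x := 1 / 4) (by norm_num) (by norm_num)]
  exact sin_le_sin_of_le_of_le_pi_div_two (neg_pi_div_two_le_arcsin _) (by linarith [hφ.2])
    (by linarith [hφ.1])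

theorem le_neg_sqrtPotential {φ : ℝ} (hφ : φ ∈ Icc (2 * arcsin (1 / 4)) π) :
    √2 * (1 / (2 * π)) * √(1 / 3) * (π - φ) ≤ -sqrtPotential φ := by
  have hs := quarter_le_sin_half hφ
  have ha : 0 ≤ arcsin (1 / 4) := arcsin_nonneg.2 (by norm_num)
  have hsin : 2 / π * ((π - φ) / 4) ≤ sin ((π - φ) / 4) :=
    mul_le_sin (by linarith [hφ.2]) (by linarith [hφ.1, pi_pos])
  have hq : 1 / 3 ≤ (4 * sin (φ / 2) ^ 2 + 4 * sin (φ / 2) - 1) / (3 * sin (φ / 2)) := by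
    rw [div_le_div_iff₀ (by norm_num) (by positivity)]
    nlinarith
  have hneg : -sqrtPotential φ = √2 * sin ((π - φ) / 4) *
      √((4 * sin (φ / 2) ^ 2 + 4 * sin (φ / 2) - 1) / (3 * sin (φ / 2))) := by
    rw [sqrtPotential, show (φ - π) / 4 = -((π - φ) / 4) by ring, Real.sin_neg]
    ring
  have hπ := sub_nonneg.2 hφ.2
  have h0 : 0 ≤ 2 / π * ((π - φ) / 4) := by have := pi_pos; positivity
  have h1 := h0.trans hsin
  rw [hneg]
  calc √2 * (1 / (2 * π)) * √(1 / 3) * (π - φ)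
      = √2 * (2 / π * ((π - φ) / 4)) * √(1 / 3) := by ring
    _ ≤ _ := by gcongr

/-- Derivative of the regular part of the period integral, away from the turning point. -/
theorem exists_bound_deriv_integral_saddle :
    ∃ C, ∀ δ ∈ Ioo (0 : ℝ) 1,
      IntervalIntegrable (fun x => (√(δ + (1 + F x)))⁻¹) volume (2 * arcsin (1 / 4)) π ∧
      ∃ d, HasDerivAt (fun t => ∫ x in (2 * arcsin (1 / 4))..π, (√(t + (1 + F x)))⁻¹) d δ ∧
        |d + √(6 / 7) / δ| ≤ C * (√δ)⁻¹ := by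
  set a := 2 * arcsin (1 / 4) with ha
  set U := {φ : ℝ | 0 < sin (φ / 2) ∧ 0 < 4 * sin (φ / 2) ^ 2 + 4 * sin (φ / 2) - 1} with hU
  have hUo : IsOpen U := by
    rw [hU, ofPred_and]
    exact (isOpen_lt (by fun_prop) (by fun_prop)).inter (isOpen_lt (by fun_prop) (by fun_prop))
  have haπ : a < π := by
    have := arcsin_lt_pi_div_two.2 (by norm_num : (1 / 4 : ℝ) < 1)
    linarith
  have hsub : Icc a π ⊆ U := fun φ hφ => by
    have := quarter_le_sin_half hφ
    exact ⟨by linarith, by nlinarith⟩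
  have hsq : ∀ φ ∈ Icc a π, sqrtPotential φ ^ 2 = 1 + F φ := fun φ hφ =>
    sqrtPotential_sq (hsub hφ).1 (hsub hφ).2
  have hgC : ContDiffOn ℝ 2 sqrtPotential U := contDiffOn_sqrtPotential
  have hgC' : ContDiffOn ℝ 1 (deriv sqrtPotential) (Icc a π) :=
    (hgC.deriv_of_isOpen hUo (by norm_num)).mono hsub
  have hGc : ContinuousOn (fun x => 1 + F x) (Icc a π) :=
    ((hgC.continuousOn.mono hsub).pow 2).congr fun φ hφ => (hsq φ hφ).symm
  obtain ⟨K, hK⟩ := hgC'.exists_lipschitzOnWith one_ne_zero (convex_Icc a π) isCompact_Icc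
  set κ := √2 / 4 * √(7 / 3) with hκ
  set m := √2 * (1 / (2 * π)) * √(1 / 3) with hm
  have hκ0 : 0 < κ := by positivity
  have hm0 : 0 < m := by have := pi_pos; positivity
  have hκ' : 1 / 2 * (1 / κ) = √(6 / 7) := by
    symm
    rw [sqrt_eq_iff_eq_sq (by norm_num) (by positivity), hκ]
    have h1 := sq_sqrt (zero_le_two (α := ℝ))
    have h2 := sq_sqrt (by norm_num : (0 : ℝ) ≤ 7 / 3)
    rw [mul_pow, div_pow, div_pow, mul_pow, div_pow (√2), h1, h2]
    norm_num
  refine ⟨1 / 2 * (κ⁻¹ * ((sqrtPotential a ^ 2)⁻¹ + K / m ^ 2)), fun δ hδ => ?_⟩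
  obtain ⟨hI, hd⟩ := hasDerivAt_integral_inv_sqrt_add haπ.le hGc
    (fun x hx => by rw [← hsq x hx]; positivity) hδ.1
  refine ⟨hI, _, hd, ?_⟩
  have hest := abs_integral_inv_mul_sqrt_sub_le haπ
    (fun x hx => ((hgC.contDiffAt (hUo.mem_nhds (hsub hx))).differentiableAt
      (by norm_num)).hasDerivAt) hgC'.continuousOn (by simp [sqrtPotential]) hκ0 hm0 K.coe_nonneg
    (fun x hx => le_neg_sqrtPotential hx) (fun x hx => by
      have := hK.dist_le_mul x hx π (right_mem_Icc.2 haπ.le)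
      rwa [deriv_sqrtPotential_pi, Real.dist_eq, Real.dist_eq, abs_sub_comm x,
        abs_of_nonneg (sub_nonneg.2 hx.2)] at this) hδ.1
  rw [intervalIntegral.integral_congr (g := fun x => ((δ + (1 + F x)) * √(δ + (1 + F x)))⁻¹)
    fun x hx => by
      rw [uIcc_of_le haπ.le] at hx
      simp only [hsq x hx]] at hest
  have hδ1 : 1 ≤ (√δ)⁻¹ :=
    (one_le_inv₀ (sqrt_pos.2 hδ.1)).2 (sqrt_le_one.2 hδ.2.le)
  rw [intervalIntegral.integral_const_mul, ← hκ']
  have e : ∀ J : ℝ, -(1 / 2) * J + 1 / 2 * (1 / κ) / δ = -(1 / 2 * (J - 1 / (κ * δ))) := fun J => by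
    have := hδ.1.ne'
    field_simp
    ring
  rw [e, abs_neg, abs_mul, abs_of_pos (by norm_num : (0 : ℝ) < 1 / 2), mul_assoc (1 / 2)]
  refine mul_le_mul_of_nonneg_left (hest.trans ?_) (by norm_num)
  rw [mul_assoc, add_mul]
  gcongr
  exact le_mul_of_one_le_right (by positivity) hδ1

theorem stmt1 (φmin : ℝ → ℝ)
    (hφmin : ∀ δ : ℝ, 0 < δ →
      φmin δ ∈ Set.Ioo 0 (π/3) ∧ 1 + δ + F (φmin δ) = 0 ∧
      ∀ φ ∈ Set.Ioo 0 (π/3), 1 + δ + F φ = 0 → φ = φmin δ) :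
    ∃ C : ℝ, 0 < C ∧ ∃ δ₀ ∈ Set.Ioo (0:ℝ) 1, ∀ δ ∈ Set.Ioo (0:ℝ) δ₀,
      ∃ d : ℝ,
        HasDerivAt (fun t => ∫ φ in (φmin t)..π, (1 + t + F φ) ^ (-(1:ℝ)/2)) d δ ∧
        |d + Real.sqrt (6/7) / δ| ≤ C * δ ^ (-(1:ℝ)/2) := by
  have hfun : ∀ t φ, (1 + t + F φ) ^ (-(1:ℝ)/2) = (√(t + (1 + F φ)))⁻¹ := fun t φ => by
    rw [rpow_neg_half_eq_inv_sqrt, add_comm 1 t, add_assoc]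
  simp only [hfun, rpow_neg_half_eq_inv_sqrt]
  have hπ := pi_pos
  have hs0 : ∀ x ∈ Ioo 0 (π / 3), 0 < sin (x / 2) := fun x hx =>
    sin_pos_of_pos_of_lt_pi (by linarith [hx.1]) (by linarith [hx.2])
  have hs : sin (arcsin (1 / 4)) = 1 / 4 := sin_arcsin (by norm_num) (by norm_num)
  have hG : ContDiffOn ℝ 3 (fun x => 1 + F x) (Ioo 0 (π / 3)) := by
    have h : ContDiff ℝ 3 (fun x : ℝ => sin (x / 2)) := contDiff_sin.comp (contDiff_id.div_const 2)
    refine ((contDiff_const.sub (contDiff_const.mul (h.pow 2))).contDiffOn.sub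
      ((contDiff_const.mul h).contDiffOn.inv fun x hx => (mul_pos three_pos (hs0 x hx)).ne')).congr
      fun x hx => one_add_F_eq (hs0 x hx)
  have hG' : ∀ x ∈ Ioo 0 (π / 3), 0 < deriv (fun x => 1 + F x) x := fun x hx => by
    have h0 := hs0 x hx
    have hlt : sin (x / 2) < 1 / 2 := by
      rw [← sin_pi_div_six]
      exact sin_lt_sin_of_lt_of_le_pi_div_two (by linarith [hx.1]) (by linarith)
        (by linarith [hx.2])
    have hcos : 0 < cos (x / 2) :=
      cos_pos_of_mem_Ioo ⟨by linarith [hx.1], by linarith [hx.2]⟩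
    rw [(hasDerivAt_one_add_F h0).deriv]
    have : sin (x / 2) ^ 3 < (1 / 2) ^ 3 := pow_lt_pow_left₀ hlt h0.le three_ne_zero
    have : 0 < 1 - 8 * sin (x / 2) ^ 3 := by linarith
    positivity
  have ha : 2 * arcsin (1 / 4) ∈ Ioo 0 (π / 3) := by
    refine ⟨mul_pos two_pos (arcsin_pos.2 (by norm_num)), ?_⟩
    by_contra! h
    have := sin_le_sin_of_le_of_le_pi_div_two (x := π / 6) (by linarith)
      (arcsin_le_pi_div_two (1 / 4)) (by linarith)
    rw [sin_pi_div_six, hs] at this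
    norm_num at this
  have hGa : 0 < 1 + F (2 * arcsin (1 / 4)) := by
    rw [one_add_F_eq (hs0 _ ha), mul_div_cancel_left₀ _ two_ne_zero, hs]
    norm_num
  obtain ⟨C₁, hC₁⟩ := exists_bound_deriv_integral_turning_point (c := φmin) hG hG' ha hGa one_pos
    fun t ht => ⟨(hφmin t ht.1).1, by linarith [(hφmin t ht.1).2.1]⟩
  obtain ⟨C₂, hC₂⟩ := exists_bound_deriv_integral_saddle
  refine ⟨|C₁| + |C₂| + 1, by positivity, 1 / 2, by norm_num, fun δ hδ => ?_⟩
  have hδ' : δ ∈ Ioo (0 : ℝ) 1 := ⟨hδ.1, hδ.2.trans (by norm_num)⟩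
  obtain ⟨_, d₁, hd₁, hb₁⟩ := hC₁ δ hδ'
  obtain ⟨_, d₂, hd₂, hb₂⟩ := hC₂ δ hδ'
  refine ⟨d₁ + d₂, (hd₁.add hd₂).congr_of_eventuallyEq ?_, ?_⟩
  · filter_upwards [Ioo_mem_nhds hδ'.1 hδ'.2] with t ht
    exact (intervalIntegral.integral_add_adjacent_intervals (hC₁ t ht).1 (hC₂ t ht).1).symm
  · have hδ1 : 1 ≤ (√δ)⁻¹ :=
      (one_le_inv₀ (sqrt_pos.2 hδ.1)).2 (sqrt_le_one.2 hδ'.2.le)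
    rw [add_assoc]
    calc |d₁ + (d₂ + √(6 / 7) / δ)| ≤ |d₁| + |d₂ + √(6 / 7) / δ| := abs_add_le _ _
      _ ≤ |C₁| * (√δ)⁻¹ + |C₂| * (√δ)⁻¹ := by
        gcongr
        · exact (hb₁.trans (le_abs_self _)).trans (le_mul_of_one_le_right (abs_nonneg _) hδ1)
        · exact hb₂.trans (by gcongr; exact le_abs_self _)
      _ ≤ (|C₁| + |C₂| + 1) * (√δ)⁻¹ := by
        rw [← add_mul]
        exact mul_le_mul_of_nonneg_right (by linarith) (by positivity)
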